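/- The precipitation function of a weak solution is essentially determined by the concentration field: if (u, p₁) and (u, p₂) are both weak solutions of the HHMO model on ℝ × [0,T] (with the same concentration u), then p₁ = p₂ almost everywhere on ℝ × [0,T]. -/

import Mathlib

open MeasureTheory Filter Set

noncomputable section

/-- The precipitation-free self-similar solution `ψ(x,t)`. -/
def psi (α β x t : ℝ) : ℝ :=
  if 0 < t then
    (α * β / 2) * Real.exp (α ^ 2 / 4) *
      ∫ ζ in Set.Ioi (max (|x| / Real.sqrt t) α), Real.exp (-ζ ^ 2 / 4)
  else 0

/-- The profile `Ψ(η)` in similarity coordinates. -/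
def PsiP (α β η : ℝ) : ℝ :=
  (α * β / 2) * Real.exp (α ^ 2 / 4) * ∫ ζ in Set.Ioi (max η α), Real.exp (-ζ ^ 2 / 4)

/-- Regularity of a weak solution: `w` is the spatial derivative of `u - ψ`;
both are continuous on `ℝ × [0,∞)` and bounded on `ℝ × [0,T]` for every `T > 0`. -/
def AuxReg (α β : ℝ) (u w : ℝ → ℝ → ℝ) : Prop :=
  (∀ t ∈ Set.Ici (0:ℝ), ∀ x : ℝ, HasDerivAt (fun y => u y t - psi α β y t) (w x t) x) ∧
  ContinuousOn (fun q : ℝ × ℝ => u q.1 q.2 - psi α β q.1 q.2) (Set.univ ×ˢ Set.Ici 0) ∧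
  ContinuousOn (fun q : ℝ × ℝ => w q.1 q.2) (Set.univ ×ˢ Set.Ici 0) ∧
  ∀ T > (0:ℝ), ∃ C : ℝ, ∀ x : ℝ, ∀ t ∈ Set.Icc (0:ℝ) T,
    |u x t - psi α β x t| ≤ C ∧ |w x t| ≤ C

/-- A test function of class `C^{1,1}(ℝ × [0,T])`, vanishing for large `|x|` and at `t = T`,
together with its partial derivatives `φt`, `φx`. -/
def IsTestFun (T : ℝ) (φ φt φx : ℝ → ℝ → ℝ) : Prop :=
  (∀ x : ℝ, ∀ t ∈ Set.Icc (0:ℝ) T,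
    HasDerivWithinAt (fun s => φ x s) (φt x t) (Set.Icc 0 T) t) ∧
  (∀ x : ℝ, ∀ t ∈ Set.Icc (0:ℝ) T, HasDerivAt (fun y => φ y t) (φx x t) x) ∧
  ContinuousOn (fun q : ℝ × ℝ => φ q.1 q.2) (Set.univ ×ˢ Set.Icc 0 T) ∧
  ContinuousOn (fun q : ℝ × ℝ => φt q.1 q.2) (Set.univ ×ˢ Set.Icc 0 T) ∧
  ContinuousOn (fun q : ℝ × ℝ => φx q.1 q.2) (Set.univ ×ˢ Set.Icc 0 T) ∧
  (∃ R : ℝ, ∀ x : ℝ, ∀ t ∈ Set.Icc (0:ℝ) T, R ≤ |x| → φ x t = 0) ∧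
  (∀ x : ℝ, φ x T = 0)

/-- The weak form of the equation, relative to a given precipitation function `p` and
the spatial derivative `w` of `u - ψ`. -/
def WeakForm (α β : ℝ) (u p w : ℝ → ℝ → ℝ) : Prop :=
  ∀ T > (0:ℝ), ∀ φ φt φx : ℝ → ℝ → ℝ, IsTestFun T φ φt φx →
    (∫ t in Set.Ioc (0:ℝ) T, ∫ x : ℝ, φt x t * (u x t - psi α β x t))
      = ∫ t in Set.Ioc (0:ℝ) T, ∫ x : ℝ, (φx x t * w x t + p x t * u x t * φ x t)

/-- A weak solution of the linear auxiliary problem with given precipitation function `p`. -/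
def IsAuxSolution (α β : ℝ) (p u : ℝ → ℝ → ℝ) : Prop :=
  (∀ x t : ℝ, u (-x) t = u x t) ∧
  ∃ w : ℝ → ℝ → ℝ, AuxReg α β u w ∧ WeakForm α β u p w

/-- A weak solution `(u, p)` of the HHMO model. -/
def IsWeakSolution (α β ustar : ℝ) (u p : ℝ → ℝ → ℝ) : Prop :=
  (∀ x t : ℝ, u (-x) t = u x t) ∧
  (∀ x t : ℝ, p (-x) t = p x t) ∧
  Measurable (fun q : ℝ × ℝ => p q.1 q.2) ∧
  (∀ x : ℝ, ∀ t ∈ Set.Ici (0:ℝ),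
    (sSup ((fun s => u x s) '' Set.Icc 0 t) < ustar → p x t = 0) ∧
    (sSup ((fun s => u x s) '' Set.Icc 0 t) = ustar → p x t ∈ Set.Icc (0:ℝ) 1) ∧
    (ustar < sSup ((fun s => u x s) '' Set.Icc 0 t) → p x t = 1)) ∧
  (∀ x : ℝ, MonotoneOn (fun t => p x t) (Set.Ici (0:ℝ))) ∧
  ∃ w : ℝ → ℝ → ℝ, AuxReg α β u w ∧ WeakForm α β u p w

/-- Condition (P): the precipitation function depends only on `x` beyond the parabola
`t = x²/α²`. -/
def CondP (α : ℝ) (p : ℝ → ℝ → ℝ) (pstar : ℝ → ℝ) : Prop :=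
  Measurable pstar ∧
  ∀ᵐ x ∂(volume.restrict (Set.Ioi (0:ℝ))), ∀ t : ℝ, x ^ 2 / α ^ 2 < t → p x t = pstar x

/-- The admissible class `𝒜` of precipitation functions. -/
def IsAdmissible (p : ℝ → ℝ → ℝ) : Prop :=
  (∀ x t : ℝ, p (-x) t = p x t) ∧
  MeasureTheory.LocallyIntegrableOn (fun q : ℝ × ℝ => p q.1 q.2) (Set.Ioi 0 ×ˢ Set.Ici 0) ∧
  ∀ T > (0:ℝ), ∃ R : ℝ, ∀ x ≥ R, ∀ t ∈ Set.Icc (0:ℝ) T, p x t = 0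

/-- `u` converges uniformly, in parabolic similarity coordinates, to the profile `Φ`. -/
def ConvUnif (u : ℝ → ℝ → ℝ) (Φ : ℝ → ℝ) : Prop :=
  ∀ ε > (0:ℝ), ∃ T : ℝ, ∀ t ≥ T, ∀ η ≥ (0:ℝ), |u (η * Real.sqrt t) t - Φ η| < ε

/-- The error function. -/
def erf (x : ℝ) : ℝ := (2 / Real.sqrt Real.pi) * ∫ s in (0:ℝ)..x, Real.exp (-s ^ 2)

/-- The complementary error function. -/
def erfc (x : ℝ) : ℝ := (2 / Real.sqrt Real.pi) * ∫ s in Set.Ioi x, Real.exp (-s ^ 2)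

/-- Kummer's confluent hypergeometric function `M(a,b,z)` (real arguments). -/
def kummerM (a b z : ℝ) : ℝ :=
  ∑' n : ℕ, (Polynomial.eval a (ascPochhammer ℝ n) / Polynomial.eval b (ascPochhammer ℝ n))
    * z ^ n / (n.factorial : ℝ)

/-- `κ = (1 + √(4γ+1))/2`, the positive root of `κ(κ-1) = γ`. -/
def kappaOf (γ : ℝ) : ℝ := (1 + Real.sqrt (4 * γ + 1)) / 2

/-- The value `u*_γ` determined by the derivative matching condition. -/
def ustarGamma (α β γ : ℝ) : ℝ :=
  (α * β / 2) *
    (kappaOf γ * kummerM (kappaOf γ / 2 + 1) (kappaOf γ + 1 / 2) (-α ^ 2 / 4) /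
        (α * kummerM (kappaOf γ / 2) (kappaOf γ + 1 / 2) (-α ^ 2 / 4)) +
      Real.exp (-α ^ 2 / 4) / (Real.sqrt Real.pi * erfc (α / 2)))⁻¹

/-- The self-similar profile `Φ_γ`. -/
def Phi (α β γ η : ℝ) : ℝ :=
  if η < α then
    ustarGamma α β γ * η ^ kappaOf γ *
      kummerM (kappaOf γ / 2) (kappaOf γ + 1 / 2) (-η ^ 2 / 4) /
      (α ^ kappaOf γ * kummerM (kappaOf γ / 2) (kappaOf γ + 1 / 2) (-α ^ 2 / 4))
  else ustarGamma α β γ * erfc (η / 2) / erfc (α / 2)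

/-- Integration by parts for two primitives, the first vanishing at the right endpoint and the
second at the left endpoint. -/
lemma integral_mul_primitive_add_primitive_mul {T : ℝ} {E k : ℝ → ℝ}
    (hE : IntervalIntegrable E volume 0 T) (hk : IntervalIntegrable k volume 0 T) :
    ∫ r in (0:ℝ)..T, (E r * (∫ s in (0:ℝ)..r, k s) + (∫ s in T..r, E s) * k r) = 0 := by
  have hθ := hE.absolutelyContinuousOnInterval_intervalIntegral (c := T) (by simp)
  have hH := hk.absolutelyContinuousOnInterval_intervalIntegral (c := 0) (by simp)
  have h := AbsolutelyContinuousOnInterval.integral_deriv_mul_eq_sub hθ hH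
  simp only [intervalIntegral.integral_same, zero_mul, mul_zero, sub_zero] at h
  refine Eq.trans ?_ h
  apply intervalIntegral.integral_congr_ae
  filter_upwards [hE.ae_hasDerivAt_integral, hk.ae_hasDerivAt_integral] with x h1 h2 hx
  have hx' := uIoc_subset_uIcc hx
  rw [(h1 hx' T (by simp)).deriv, (h2 hx' 0 (by simp)).deriv]

/-- A continuous function whose square has vanishing integral is zero. -/
lemma eq_zero_of_integral_mul_self_eq_zero {T : ℝ} (hT : 0 < T) {E : ℝ → ℝ} (hE : Continuous E)
    (h : ∫ r in (0:ℝ)..T, E r * E r = 0) : ∀ t ∈ Icc (0:ℝ) T, E t = 0 := by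
  intro t ht
  by_contra hne
  have := intervalIntegral.integral_pos hT (f := fun r => E r * E r)
    (hE.mul hE).continuousOn (fun x _ => mul_self_nonneg _)
    ⟨t, ht, mul_self_pos.2 hne⟩
  linarith

lemma integrable_mul_of_bound {X : Type*} [TopologicalSpace X] [MeasureSpace X]
    [OpensMeasurableSpace X] [IsFiniteMeasureOnCompacts (volume : Measure X)]
    {b g : X → ℝ} (hb : Continuous b) (hbc : HasCompactSupport b)
    (hg : AEStronglyMeasurable g) {C : ℝ} (hgb : ∀ x, |g x| ≤ C) :
    Integrable (fun x => b x * g x) :=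
  (hb.integrable_of_hasCompactSupport hbc).mul_bdd (c := C) hg (Eventually.of_forall hgb)

lemma continuous_integral_mul {b : ℝ → ℝ} (hb : Continuous b) (hbc : HasCompactSupport b)
    {v : ℝ → ℝ → ℝ} (hv : Continuous (Function.uncurry v)) {C : ℝ} (hvb : ∀ x t, |v x t| ≤ C) :
    Continuous fun t => ∫ y, b y * v y t := by
  refine continuous_of_dominated (bound := fun y => |b y| * C) ?_ ?_ ?_ ?_
  · intro t; exact Continuous.aestronglyMeasurable (by fun_prop)
  · intro t
    refine Eventually.of_forall fun y => ?_
    rw [Real.norm_eq_abs, abs_mul]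
    exact mul_le_mul_of_nonneg_left (hvb y t) (abs_nonneg _)
  · exact ((hb.integrable_of_hasCompactSupport hbc).abs).mul_const C
  · refine Eventually.of_forall fun y => ?_
    fun_prop

lemma intervalIntegrable_integral_mul {b : ℝ → ℝ} (hb : Continuous b) (hbc : HasCompactSupport b)
    {f : ℝ → ℝ → ℝ} (hf : Measurable (Function.uncurry f)) {C : ℝ} (hfb : ∀ x t, |f x t| ≤ C)
    (c d : ℝ) : IntervalIntegrable (fun t => ∫ y, b y * f y t) volume c d := by
  have hgm : StronglyMeasurable fun t => ∫ y, b y * f y t := by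
    apply StronglyMeasurable.integral_prod_right' (f := fun q : ℝ × ℝ => b q.2 * f q.2 q.1)
    have := hb.measurable
    exact Measurable.stronglyMeasurable (by fun_prop)
  have hgb : ∀ t, |∫ y, b y * f y t| ≤ ∫ y, |b y| * C := by
    intro t
    refine norm_integral_le_of_norm_le (f := fun y => b y * f y t)
      ((hb.integrable_of_hasCompactSupport hbc).abs.mul_const C)
      (Eventually.of_forall fun y => ?_)
    rw [Real.norm_eq_abs, abs_mul]
    exact mul_le_mul_of_nonneg_left (hfb y t) (abs_nonneg _)
  exact (intervalIntegrable_const (c := ∫ y, |b y| * C)).mono_fun hgm.aestronglyMeasurable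
    (Eventually.of_forall fun t => (hgb t).trans (le_abs_self _))

/-- Testing the weak equation with a product of a spatial bump `b` and an arbitrary primitive in
time gives an integrated evolution equation for the spatial averages `∫ b v`. -/
lemma integral_mul_eq_of_weak {T C : ℝ} (hT : 0 < T) {v w f : ℝ → ℝ → ℝ}
    (hv : Continuous (Function.uncurry v)) (hw : Continuous (Function.uncurry w))
    (hd : ∀ x t, HasDerivAt (fun y => v y t) (w x t) x)
    (hvb : ∀ x t, |v x t| ≤ C) (hwb : ∀ x t, |w x t| ≤ C)
    (hf : Measurable (Function.uncurry f)) (hfb : ∀ x t, |f x t| ≤ C)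
    (weak : ∀ φ φt φx : ℝ → ℝ → ℝ, IsTestFun T φ φt φx →
      (∫ t in Ioc (0:ℝ) T, ∫ x : ℝ, φt x t * v x t)
        = ∫ t in Ioc (0:ℝ) T, ∫ x : ℝ, (φx x t * w x t + f x t * φ x t))
    {b : ℝ → ℝ} (hb : ContDiff ℝ 2 b) (hbc : HasCompactSupport b) :
    ∀ t ∈ Icc (0:ℝ) T, ∫ y, b y * v y t =
      ∫ s in (0:ℝ)..t, ((∫ y, deriv (deriv b) y * v y s) - ∫ y, b y * f y s) := by
  have hb1 : ContDiff ℝ 1 (deriv b) := by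
    have : ContDiff ℝ (1 + 1) b := by simpa [one_add_one_eq_two] using hb
    exact (contDiff_succ_iff_deriv.1 this).2.2
  have hbd : Differentiable ℝ b := hb.differentiable (by norm_num)
  have hb'd : Differentiable ℝ (deriv b) := hb1.differentiable (by norm_num)
  have hb''c : Continuous (deriv (deriv b)) := hb1.continuous_deriv le_rfl
  have hvt : ∀ t, Continuous fun y => v y t := fun t => by fun_prop
  have hwt : ∀ t, Continuous fun y => w y t := fun t => by fun_prop
  have hft : ∀ t, Measurable fun y => f y t := fun t => by fun_prop
  have hparts : ∀ t, ∫ y, deriv b y * w y t = - ∫ y, deriv (deriv b) y * v y t := by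
    intro t
    apply integral_mul_deriv_eq_deriv_mul_of_integrable
      (fun x _ => (hb'd x).hasDerivAt) (fun x _ => hd x t)
    · exact integrable_mul_of_bound hb1.continuous hbc.deriv (hwt t).aestronglyMeasurable
        (fun x => hwb x t)
    · exact integrable_mul_of_bound hb''c hbc.deriv.deriv (hvt t).aestronglyMeasurable
        (fun x => hvb x t)
    · exact integrable_mul_of_bound hb1.continuous hbc.deriv (hvt t).aestronglyMeasurable
        (fun x => hvb x t)
  set k : ℝ → ℝ := fun s => (∫ y, deriv (deriv b) y * v y s) - ∫ y, b y * f y s with hk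
  have hki : ∀ c d, IntervalIntegrable k volume c d := by
    intro c d
    exact ((continuous_integral_mul hb''c hbc.deriv.deriv hv hvb).intervalIntegrable c d).sub
      (intervalIntegrable_integral_mul hb.continuous hbc hf hfb c d)
  have hHc : Continuous fun t => ∫ s in (0:ℝ)..t, k s :=
    intervalIntegral.continuous_primitive hki 0
  have hVc := continuous_integral_mul hb.continuous hbc hv hvb
  set E : ℝ → ℝ := fun t => (∫ y, b y * v y t) - ∫ s in (0:ℝ)..t, k s with hE
  have hEc : Continuous E := hVc.sub hHc
  set θ : ℝ → ℝ := fun t => ∫ s in T..t, E s with hθ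
  have hθd : ∀ t, HasDerivAt θ (E t) t := fun t => hEc.integral_hasStrictDerivAt T t |>.hasDerivAt
  have hθc : Continuous θ := continuous_iff_continuousAt.2 fun t => (hθd t).continuousAt
  have htest := weak (fun x t => b x * θ t) (fun x t => b x * E t) (fun x t => deriv b x * θ t)
    ⟨fun x t _ => ((hθd t).const_mul (b x)).hasDerivWithinAt,
      fun x t _ => (hbd x).hasDerivAt.mul_const _,
      by have := hb.continuous; fun_prop, by have := hb.continuous; fun_prop,
      by have := hb1.continuous; fun_prop,
      by
        obtain ⟨R, hR⟩ := hbc.isCompact.isBounded.exists_norm_le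
        refine ⟨R + 1, fun x t _ hx => ?_⟩
        have : b x = 0 := by
          by_contra hne
          have := hR x (subset_tsupport _ hne)
          rw [Real.norm_eq_abs] at this
          linarith
        simp [this],
      fun x => by simp [hθ]⟩
  rw [← intervalIntegral.integral_of_le hT.le, ← intervalIntegral.integral_of_le hT.le] at htest
  have hL : ∀ t, ∫ x, b x * E t * v x t = E t * ∫ y, b y * v y t := by
    intro t
    rw [← integral_const_mul]
    congr 1; ext y; ring
  have hR : ∀ t, ∫ x, (deriv b x * θ t * w x t + f x t * (b x * θ t)) = - (θ t * k t) := by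
    intro t
    have e : (fun x => deriv b x * θ t * w x t + f x t * (b x * θ t))
        = fun x => θ t * (deriv b x * w x t + b x * f x t) := by ext x; ring
    rw [e, integral_const_mul, integral_add, hparts]
    · simp only [hk]; ring
    · exact integrable_mul_of_bound hb1.continuous hbc.deriv (hwt t).aestronglyMeasurable
        (fun x => hwb x t)
    · exact integrable_mul_of_bound hb.continuous hbc (hft t).aestronglyMeasurable
        (fun x => hfb x t)
  simp only [hL, hR] at htest
  have hzero := integral_mul_primitive_add_primitive_mul (T := T) (E := E) (k := k)
    (hEc.intervalIntegrable _ _) (hki _ _)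
  have hi1 : IntervalIntegrable (fun t => E t * ∫ y, b y * v y t) volume 0 T :=
    (hEc.mul hVc).intervalIntegrable _ _
  have hi2 : IntervalIntegrable (fun t => E t * ∫ s in (0:ℝ)..t, k s) volume 0 T :=
    (hEc.mul hHc).intervalIntegrable _ _
  have hi3 : IntervalIntegrable (fun t => θ t * k t) volume 0 T :=
    (hki 0 T).continuousOn_mul hθc.continuousOn
  rw [intervalIntegral.integral_add hi2 hi3] at hzero
  rw [intervalIntegral.integral_neg] at htest
  have hsq : ∫ r in (0:ℝ)..T, E r * E r = 0 := by
    have e : (fun r => E r * E r)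
        = fun r => E r * (∫ y, b y * v y r) - E r * ∫ s in (0:ℝ)..r, k s := by
      ext r; simp only [hE]; ring
    rw [e, intervalIntegral.integral_sub hi1 hi2]
    linarith
  intro t ht
  have := eq_zero_of_integral_mul_self_eq_zero hT hEc hsq t ht
  simp only [hE] at this
  linarith

/-- The unnormalized Gaussian tail integral. -/
def gaussTail (η : ℝ) : ℝ := ∫ ζ in Ioi η, Real.exp (-ζ ^ 2 / 4)

lemma integrable_exp_neg_sq_div_four : Integrable fun ζ : ℝ => Real.exp (-ζ ^ 2 / 4) := by
  have := integrable_exp_neg_mul_sq (b := 1 / 4) (by norm_num)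
  refine this.congr (Eventually.of_forall fun ζ => ?_)
  simp only
  congr 1; ring

lemma hasDerivAt_gaussTail (η : ℝ) : HasDerivAt gaussTail (-Real.exp (-η ^ 2 / 4)) η := by
  have e : gaussTail = fun η => gaussTail 0 - ∫ ζ in (0:ℝ)..η, Real.exp (-ζ ^ 2 / 4) := by
    ext η
    have := intervalIntegral.integral_interval_add_Ioi (a := (0:ℝ)) (b := η)
      integrable_exp_neg_sq_div_four.integrableOn integrable_exp_neg_sq_div_four.integrableOn
    simp only [gaussTail]
    linarith
  rw [e]
  have hc : Continuous fun ζ : ℝ => Real.exp (-ζ ^ 2 / 4) := by fun_prop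
  exact (hc.integral_hasStrictDerivAt 0 η).hasDerivAt.const_sub _

lemma gaussTail_pos (η : ℝ) : 0 < gaussTail η := by
  rw [gaussTail, setIntegral_pos_iff_support_of_nonneg_ae]
  · have : Function.support (fun ζ : ℝ => Real.exp (-ζ ^ 2 / 4)) = univ := by
      ext ζ; simp [(Real.exp_pos _).ne']
    rw [this]; simp
  · exact Eventually.of_forall fun ζ => (Real.exp_pos _).le
  · exact integrable_exp_neg_sq_div_four.integrableOn

lemma gaussTail_antitone : Antitone gaussTail :=
  antitone_of_deriv_nonpos (fun η => (hasDerivAt_gaussTail η).differentiableAt)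
    (fun η => by rw [(hasDerivAt_gaussTail η).deriv]; simpa using (Real.exp_pos _).le)

lemma continuous_gaussTail : Continuous gaussTail :=
  continuous_iff_continuousAt.2 fun η => (hasDerivAt_gaussTail η).continuousAt

lemma abs_gaussTail_sub_le (a b : ℝ) : |gaussTail a - gaussTail b| ≤ |a - b| := by
  have h : LipschitzWith 1 gaussTail := by
    refine lipschitzWith_of_nnnorm_deriv_le
      (fun η => (hasDerivAt_gaussTail η).differentiableAt) (fun η => ?_)
    rw [(hasDerivAt_gaussTail η).deriv, nnnorm_neg, ← NNReal.coe_le_coe, coe_nnnorm,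
      Real.norm_eq_abs, abs_of_pos (Real.exp_pos _)]
    simp only [NNReal.coe_one, Real.exp_le_one_iff]
    nlinarith [sq_nonneg η]
  simpa [Real.dist_eq] using h.dist_le_mul a b

/-- The amplitude of the self-similar solution `psi`. -/
def psiAmp (α β : ℝ) : ℝ := (α * β / 2) * Real.exp (α ^ 2 / 4)

lemma psiAmp_pos {α β : ℝ} (hα : 0 < α) (hβ : 0 < β) : 0 < psiAmp α β := by
  unfold psiAmp; positivity

lemma psi_of_pos {α β x t : ℝ} (ht : 0 < t) :
    psi α β x t = psiAmp α β * gaussTail (max (|x| / Real.sqrt t) α) := by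
  simp [psi, ht, psiAmp, gaussTail]

lemma psi_pos {α β : ℝ} (hα : 0 < α) (hβ : 0 < β) {x t : ℝ} (ht : 0 < t) :
    0 < psi α β x t := by
  rw [psi_of_pos ht]
  exact mul_pos (psiAmp_pos hα hβ) (gaussTail_pos _)

lemma psi_nonneg {α β : ℝ} (hα : 0 < α) (hβ : 0 < β) (x t : ℝ) : 0 ≤ psi α β x t := by
  by_cases ht : 0 < t
  · exact (psi_pos hα hβ ht).le
  · simp [psi, ht]

lemma psi_le {α β : ℝ} (hα : 0 < α) (hβ : 0 < β) (x t : ℝ) :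
    psi α β x t ≤ psiAmp α β * gaussTail α := by
  by_cases ht : 0 < t
  · rw [psi_of_pos ht]
    exact mul_le_mul_of_nonneg_left (gaussTail_antitone (le_max_right _ _)) (psiAmp_pos hα hβ).le
  · simp only [psi, ht, if_false]
    exact mul_nonneg (psiAmp_pos hα hβ).le (gaussTail_pos _).le

lemma continuousOn_psi (α β : ℝ) :
    ContinuousOn (fun q : ℝ × ℝ => psi α β q.1 q.2) (univ ×ˢ Ioi 0) := by
  have h : ContinuousOn
      (fun q : ℝ × ℝ => psiAmp α β * gaussTail (max (|q.1| / Real.sqrt q.2) α))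
      (univ ×ˢ Ioi 0) := by
    refine continuousOn_const.mul (continuous_gaussTail.comp_continuousOn ?_)
    refine ContinuousOn.sup ?_ continuousOn_const
    refine ContinuousOn.div (by fun_prop) (by fun_prop) fun q hq => ?_
    exact (Real.sqrt_pos.2 hq.2).ne'
  exact h.congr fun q hq => psi_of_pos hq.2

/-- `psi` is a minimum of smooth solutions of the heat equation: at each point it is touched from
above by one of them. -/
lemma exists_heat_solution_touching_psi {α β : ℝ} (hα : 0 < α) (hβ : 0 < β) (x₀ : ℝ) {t₀ : ℝ}
    (ht₀ : 0 < t₀) :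
    ∃ h : ℝ → ℝ → ℝ, (∀ x t, 0 < t → psi α β x t ≤ h x t) ∧ psi α β x₀ t₀ = h x₀ t₀ ∧
      (∀ x y t, 0 < t → |h x t - h y t| ≤ psiAmp α β * |x - y| / Real.sqrt t) ∧
      ∃ (hx : ℝ → ℝ) (D : ℝ), HasDerivAt (h x₀) D t₀ ∧
        (∀ x, HasDerivAt (fun y => h y t₀) (hx x) x) ∧ HasDerivAt hx D x₀ := by
  have hc := psiAmp_pos hα hβ
  set c := psiAmp α β
  by_cases hcase : |x₀| / Real.sqrt t₀ ≤ α
  · refine ⟨fun _ _ => c * gaussTail α, fun x t _ => psi_le hα hβ x t, ?_, ?_,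
      fun _ => 0, 0, hasDerivAt_const _ _, fun x => hasDerivAt_const _ _, hasDerivAt_const _ _⟩
    · rw [psi_of_pos ht₀, max_eq_right hcase]
    · intro x y t _
      simp only [sub_self, abs_zero]
      positivity
  · push Not at hcase
    obtain ⟨σ, hσ, hσx⟩ : ∃ σ : ℝ, |σ| = 1 ∧ σ * x₀ = |x₀| := by
      rcases le_total 0 x₀ with h | h
      · exact ⟨1, by simp, by simp [abs_of_nonneg h]⟩
      · exact ⟨-1, by simp, by simp [abs_of_nonpos h]⟩
    have hs₀ := Real.sqrt_pos.2 ht₀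
    refine ⟨fun x t => c * gaussTail (σ * x / Real.sqrt t), ?_, ?_, ?_,
      fun x => c * (-Real.exp (-(σ * x / Real.sqrt t₀) ^ 2 / 4) * (σ / Real.sqrt t₀)),
      c * (-Real.exp (-(σ * x₀ / Real.sqrt t₀) ^ 2 / 4) *
        (-(σ * x₀) / (2 * t₀ * Real.sqrt t₀))), ?_, ?_, ?_⟩
    · intro x t ht
      rw [psi_of_pos ht]
      refine mul_le_mul_of_nonneg_left (gaussTail_antitone (le_max_of_le_left ?_)) hc.le
      have : σ * x ≤ |x| := by
        calc σ * x ≤ |σ * x| := le_abs_self _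
          _ = |x| := by rw [abs_mul, hσ, one_mul]
      gcongr
    · simp only
      rw [psi_of_pos ht₀, max_eq_left hcase.le, hσx]
    · intro x y t ht
      have hs := Real.sqrt_pos.2 ht
      rw [← mul_sub, abs_mul, abs_of_pos hc, mul_div_assoc c]
      refine mul_le_mul_of_nonneg_left ((abs_gaussTail_sub_le _ _).trans (le_of_eq ?_)) hc.le
      rw [← sub_div, ← mul_sub, abs_div, abs_mul, hσ, one_mul, abs_of_pos hs]
    · have h1 : HasDerivAt (fun t => σ * x₀ / Real.sqrt t)
          (-(σ * x₀) / (2 * t₀ * Real.sqrt t₀)) t₀ := by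
        have := (hasDerivAt_const t₀ (σ * x₀)).div (Real.hasDerivAt_sqrt ht₀.ne') hs₀.ne'
        refine this.congr_deriv ?_
        rw [Real.sq_sqrt ht₀.le]
        field_simp
        ring
      exact ((hasDerivAt_gaussTail _).comp t₀ h1).const_mul c
    · intro x
      have h1 : HasDerivAt (fun x => σ * x / Real.sqrt t₀) (σ / Real.sqrt t₀) x := by
        simpa using ((hasDerivAt_id x).const_mul σ).div_const (Real.sqrt t₀)
      exact ((hasDerivAt_gaussTail _).comp x h1).const_mul c
    · have h1 : HasDerivAt (fun x => σ * x / Real.sqrt t₀) (σ / Real.sqrt t₀) x₀ := by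
        simpa using ((hasDerivAt_id x₀).const_mul σ).div_const (Real.sqrt t₀)
      have h2 := ((((h1.pow 2).neg.div_const 4).exp.neg).mul_const (σ / Real.sqrt t₀)).const_mul c
      refine h2.congr_deriv ?_
      have hσ2 : σ ^ 2 = 1 := by rw [← sq_abs, hσ, one_pow]
      have e : (-(2 * (σ * x₀ / Real.sqrt t₀) * (σ / Real.sqrt t₀)) / 4) * (σ / Real.sqrt t₀)
          = -(σ * x₀) / (2 * t₀ * Real.sqrt t₀) := by
        have : (-(2 * (σ * x₀ / Real.sqrt t₀) * (σ / Real.sqrt t₀)) / 4) * (σ / Real.sqrt t₀)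
          = -(σ ^ 2 * (σ * x₀)) / (2 * Real.sqrt t₀ ^ 2 * Real.sqrt t₀) := by
          field_simp
          ring
        rw [this, hσ2, Real.sq_sqrt ht₀.le, one_mul]
      rw [← e]
      simp only [Pi.neg_apply, Pi.pow_apply, Nat.cast_ofNat, Nat.add_one_sub_one, pow_one]
      ring

/-- The second derivative is nonnegative at a global minimum. -/
lemma second_deriv_nonneg_of_min {F F' : ℝ → ℝ} {x₀ D : ℝ} (h1 : ∀ x, HasDerivAt F (F' x) x)
    (h2 : HasDerivAt F' D x₀) (hmin : ∀ x, F x₀ ≤ F x) : 0 ≤ D := by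
  by_contra! hD
  have hF' : deriv F = F' := funext fun x => (h1 x).deriv
  have hlm : IsLocalMin F x₀ := Eventually.of_forall hmin
  have h0 : deriv F x₀ = 0 := hlm.deriv_eq_zero
  have hmax : IsLocalMax F x₀ := isLocalMax_of_deriv_deriv_neg
    (by rw [hF', h2.deriv]; exact hD) h0 (h1 x₀).continuousAt
  have hconst : F =ᶠ[nhds x₀] fun _ => F x₀ := by
    filter_upwards [hmax] with x hx using le_antisymm hx (hmin x)
  have hd : deriv F =ᶠ[nhds x₀] deriv fun _ => F x₀ := hconst.deriv
  rw [hF'] at hd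
  have := hd.deriv_eq
  rw [h2.deriv] at this
  simp at this
  linarith

/-- The derivative is nonpositive at a minimum from the left. -/
lemma deriv_nonpos_of_left_min {R : ℝ → ℝ} {t₀ s₁ D : ℝ} (hs : s₁ < t₀)
    (h : HasDerivAt R D t₀) (hmin : ∀ s, s₁ < s → s < t₀ → R t₀ ≤ R s) : D ≤ 0 := by
  have h1 := (hasDerivWithinAt_iff_tendsto_slope' (s := Iio t₀) (by simp)).1
    (h.hasDerivWithinAt (s := Iio t₀))
  refine le_of_tendsto h1 ?_
  filter_upwards [Ioo_mem_nhdsLT hs] with s hs'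
  rw [slope_def_field]
  exact div_nonpos_of_nonneg_of_nonpos (sub_nonneg.2 (hmin s hs'.1 hs'.2)) (by linarith [hs'.2])

lemma continuousOn_exp_sub_one_mul_psi {α β : ℝ} (hα : 0 < α) (hβ : 0 < β) :
    ContinuousOn (fun q : ℝ × ℝ => (Real.exp q.2 - 1) * psi α β q.1 q.2) (univ ×ˢ Ici 0) := by
  rintro ⟨x, t⟩ ⟨-, ht⟩
  rcases (show (0:ℝ) ≤ t from ht).eq_or_lt with rfl | ht
  · refine ContinuousAt.continuousWithinAt ?_
    have hz : Tendsto (fun q : ℝ × ℝ => (Real.exp q.2 - 1)) (nhds (x, 0)) (nhds 0) := by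
      have : Continuous fun q : ℝ × ℝ => (Real.exp q.2 - 1) := by fun_prop
      simpa using this.tendsto (x, 0)
    have hb : IsBoundedUnder (· ≤ ·) (nhds (x, (0:ℝ)))
        ((fun y => ‖y‖) ∘ fun q : ℝ × ℝ => psi α β q.1 q.2) := by
      refine isBoundedUnder_of ⟨psiAmp α β * gaussTail α, fun q => ?_⟩
      simp only [Function.comp, Real.norm_eq_abs, abs_of_nonneg (psi_nonneg hα hβ _ _)]
      exact psi_le hα hβ _ _
    have := hz.zero_mul_isBoundedUnder_le hb
    simpa [ContinuousAt] using this
  · refine ContinuousAt.continuousWithinAt (ContinuousAt.mul (by fun_prop) ?_)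
    exact (continuousOn_psi α β).continuousAt
      ((isOpen_univ.prod isOpen_Ioi).mem_nhds ⟨mem_univ _, ht⟩)

/-- Comparison principle for a spatially smooth field `V` whose time increments dominate those of
`V₂ - g`, with `V₂` the second spatial derivative of `V`. -/
lemma comparison_of_integrated_inequality {α β T C N ε : ℝ} (hα : 0 < α) (hβ : 0 < β)
    (hN : 0 ≤ N) (hε : 0 < ε) {V V₁ V₂ g : ℝ → ℝ → ℝ}
    (hV : Continuous (Function.uncurry V)) (hVb : ∀ x t, |V x t| ≤ C)
    (hV1 : ∀ x t, HasDerivAt (fun y => V y t) (V₁ x t) x)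
    (hV2 : ∀ x t, HasDerivAt (fun y => V₁ y t) (V₂ x t) x)
    (hV2c : ∀ x, Continuous (V₂ x)) (hV0 : ∀ x, V x 0 = 0)
    (hinc : ∀ x s t m, 0 < s → s < t → t ≤ T → (∀ r ∈ Icc s t, m ≤ V₂ x r - g x r) →
      m * (t - s) ≤ V x t - V x s)
    (hg : ∀ x r K, 0 < r → r ≤ T → (∀ y, |x - y| ≤ ε → psi α β y r ≤ K) →
      g x r ≤ V x r + K + N * Real.exp r)
    (lam : ℝ) (hlam : 0 < lam) :
    ∀ x, ∀ t ∈ Icc (0:ℝ) T, 0 ≤ Real.exp t * V x t + (Real.exp t - 1) * psi α β x t +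
      N / 2 * Real.exp (2 * t) + lam * (x ^ 2 + 3 * t) +
      2 * Real.exp T * psiAmp α β * ε * Real.sqrt t := by
  by_contra! hcon
  obtain ⟨x₁, t₁, ht₁, hneg⟩ := hcon
  have hc := psiAmp_pos hα hβ
  set c := psiAmp α β with hcdef
  set D := 2 * Real.exp T * c * ε with hD
  have hDpos : 0 < D := by positivity
  set F : ℝ × ℝ → ℝ := fun q => Real.exp q.2 * V q.1 q.2 + (Real.exp q.2 - 1) * psi α β q.1 q.2 +
      N / 2 * Real.exp (2 * q.2) + lam * (q.1 ^ 2 + 3 * q.2) + D * Real.sqrt q.2 with hF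
  have hFc : ContinuousOn F (univ ×ˢ Ici 0) := by
    have := continuousOn_exp_sub_one_mul_psi hα hβ (α := α) (β := β)
    have hV' : Continuous fun q : ℝ × ℝ => V q.1 q.2 := hV
    refine ContinuousOn.add (ContinuousOn.add (ContinuousOn.add (ContinuousOn.add ?_ this) ?_) ?_) ?_
    all_goals exact Continuous.continuousOn (by fun_prop)
  have hC : 0 ≤ C := (abs_nonneg _).trans (hVb 0 0)
  have hFlow : ∀ x, ∀ t ∈ Icc (0:ℝ) T, lam * x ^ 2 - Real.exp T * C ≤ F (x, t) := by
    intro x t ht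
    have e1 : -(Real.exp T * C) ≤ Real.exp t * V x t := by
      have h1 : Real.exp t ≤ Real.exp T := Real.exp_le_exp.2 ht.2
      have h2 := neg_abs_le (V x t)
      have h3 := hVb x t
      have h4 := Real.exp_pos t
      nlinarith
    have e2 : 0 ≤ (Real.exp t - 1) * psi α β x t :=
      mul_nonneg (by linarith [Real.one_le_exp ht.1]) (psi_nonneg hα hβ _ _)
    have e3 : 0 ≤ N / 2 * Real.exp (2 * t) := by positivity
    have e4 : 0 ≤ D * Real.sqrt t := by positivity
    have e5 : 0 ≤ lam * t := mul_nonneg hlam.le ht.1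
    simp only [hF]
    linarith
  have hF1 : F (x₁, t₁) < 0 := hneg
  set R := |x₁| + Real.sqrt (Real.exp T * C / lam) with hR
  have hRs : 0 ≤ Real.sqrt (Real.exp T * C / lam) := Real.sqrt_nonneg _
  have hout : ∀ x, R < |x| → ∀ t ∈ Icc (0:ℝ) T, 0 ≤ F (x, t) := by
    intro x hx t ht
    refine le_trans ?_ (hFlow x t ht)
    have h1 : Real.sqrt (Real.exp T * C / lam) ≤ |x| := by linarith [abs_nonneg x₁]
    have h2 : Real.exp T * C / lam ≤ x ^ 2 := by
      rw [← sq_abs x]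
      exact (Real.sqrt_le_left (abs_nonneg x)).1 h1
    rw [div_le_iff₀ hlam] at h2
    linarith
  obtain ⟨⟨x₀, t₀⟩, ⟨hx₀, ht₀⟩, hminK⟩ :=
    (isCompact_Icc.prod isCompact_Icc : IsCompact (Icc (-R) R ×ˢ Icc (0:ℝ) T)).exists_isMinOn
      ⟨(x₁, t₁), ⟨abs_le.1 (by linarith), ht₁⟩⟩
      (hFc.mono (prod_mono (subset_univ _) (fun t ht => ht.1)))
  have hF0 : F (x₀, t₀) < 0 :=
    (hminK (show (x₁, t₁) ∈ Icc (-R) R ×ˢ Icc (0:ℝ) T from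
      ⟨abs_le.1 (by linarith), ht₁⟩)).trans_lt hF1
  have hmin : ∀ x, ∀ t ∈ Icc (0:ℝ) T, F (x₀, t₀) ≤ F (x, t) := by
    intro x t ht
    by_cases hx : R < |x|
    · exact hF0.le.trans (hout x hx t ht)
    · exact hminK (show (x, t) ∈ Icc (-R) R ×ˢ Icc (0:ℝ) T from
        ⟨abs_le.1 (not_lt.1 hx), ht⟩)
  have ht₀pos : 0 < t₀ := by
    refine lt_of_le_of_ne ht₀.1 fun h => ?_
    have h0 : t₀ = 0 := h.symm
    simp only [hF, h0, hV0, Real.exp_zero, mul_zero, Real.sqrt_zero] at hF0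
    have : 0 ≤ lam * x₀ ^ 2 := by positivity
    linarith
  have ht₀T : t₀ ≤ T := ht₀.2
  have hs₀ := Real.sqrt_pos.2 ht₀pos
  obtain ⟨h, hle, heq, hlip, hx, Dh, hht, hhx, hhxx⟩ :=
    exists_heat_solution_touching_psi hα hβ x₀ ht₀pos
  have hE := Real.exp_pos t₀
  have hE1 : 0 ≤ Real.exp t₀ - 1 := by linarith [Real.one_le_exp ht₀.1]
  -- spatial second-order condition
  have hspace : 0 ≤ Real.exp t₀ * V₂ x₀ t₀ + (Real.exp t₀ - 1) * Dh + lam * 2 := by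
    refine second_deriv_nonneg_of_min
      (F := fun x => Real.exp t₀ * V x t₀ + (Real.exp t₀ - 1) * h x t₀ + lam * x ^ 2)
      (F' := fun x => Real.exp t₀ * V₁ x t₀ + (Real.exp t₀ - 1) * hx x + lam * (2 * x))
      (x₀ := x₀) ?_ ?_ ?_
    · intro x
      refine (((hV1 x t₀).const_mul _).add ((hhx x).const_mul _)).add (HasDerivAt.const_mul _ ?_)
      simpa using hasDerivAt_pow 2 x
    · refine (((hV2 x₀ t₀).const_mul _).add (hhxx.const_mul _)).add (HasDerivAt.const_mul _ ?_)
      simpa using (hasDerivAt_id x₀).const_mul 2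
    · intro x
      have h1 := hmin x t₀ ht₀
      have h2 := mul_le_mul_of_nonneg_left (hle x t₀ ht₀pos) hE1
      simp only [hF, heq] at h1
      linarith
  -- temporal first-order condition
  set G : ℝ → ℝ := fun r => V₂ x₀ r - (V x₀ r + (h x₀ r + c * ε / Real.sqrt r) + N * Real.exp r)
    with hG
  have hGc : ContinuousAt G t₀ := by
    have e1 : ContinuousAt (V₂ x₀) t₀ := (hV2c x₀).continuousAt
    have e2 : ContinuousAt (V x₀) t₀ := by
      have : Continuous fun t => V x₀ t := by fun_prop
      exact this.continuousAt
    have e3 : ContinuousAt (h x₀) t₀ := hht.continuousAt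
    have e4 : ContinuousAt (fun r => c * ε / Real.sqrt r) t₀ :=
      continuousAt_const.div (by fun_prop) hs₀.ne'
    exact e1.sub ((e2.add (e3.add e4)).add (by fun_prop))
  set η := lam * Real.exp (-t₀) / 2 with hη
  have hηpos : 0 < η := by positivity
  have hηe : Real.exp t₀ * η = lam / 2 := by
    rw [hη, Real.exp_neg]; field_simp
  obtain ⟨δ, hδ, hball⟩ := Metric.eventually_nhds_iff.1
    (hGc.eventually (lt_mem_nhds (show G t₀ - η < G t₀ by linarith)))
  have hVinc : ∀ s, max 0 (t₀ - δ) < s → s < t₀ →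
      (G t₀ - η) * (t₀ - s) ≤ V x₀ t₀ - V x₀ s := by
    intro s hs hst
    have hs1 : 0 < s := (le_max_left _ _).trans_lt hs
    have hs2 : t₀ - δ < s := (le_max_right _ _).trans_lt hs
    refine hinc x₀ s t₀ _ hs1 hst ht₀T fun r hr => ?_
    have hr0 : 0 < r := hs1.trans_le hr.1
    have h1 := hball (y := r) (by rw [Real.dist_eq, abs_lt]; constructor <;> linarith [hr.1, hr.2])
    have h2 := hg x₀ r (h x₀ r + c * ε / Real.sqrt r) hr0 (hr.2.trans ht₀T) (by
      intro y hy
      have e1 := hle y r hr0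
      have e2 := (abs_le.1 (hlip x₀ y r hr0)).1
      have e3 : c * |x₀ - y| / Real.sqrt r ≤ c * ε / Real.sqrt r := by gcongr
      linarith)
    simp only [hG] at h1 ⊢
    linarith
  have htime : Real.exp t₀ * V x₀ t₀ + Real.exp t₀ * (G t₀ - η) + (Real.exp t₀ * h x₀ t₀ +
      (Real.exp t₀ - 1) * Dh) + N / 2 * (Real.exp (2 * t₀) * 2) + lam * 3 +
      D * (1 / (2 * Real.sqrt t₀)) ≤ 0 := by
    refine deriv_nonpos_of_left_min (t₀ := t₀) (s₁ := max 0 (t₀ - δ))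
      (R := fun s => Real.exp s * (V x₀ t₀ + (G t₀ - η) * (s - t₀)) + (Real.exp s - 1) * h x₀ s +
        N / 2 * Real.exp (2 * s) + lam * (x₀ ^ 2 + 3 * s) + D * Real.sqrt s)
      (max_lt ht₀pos (by linarith)) ?_ ?_
    · refine HasDerivAt.add (HasDerivAt.add (HasDerivAt.add (HasDerivAt.add ?_ ?_) ?_) ?_) ?_
      · have := (Real.hasDerivAt_exp t₀).mul
          ((((hasDerivAt_id t₀).sub_const t₀).const_mul (G t₀ - η)).const_add (V x₀ t₀))
        refine this.congr_deriv ?_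
        simp
      · exact ((Real.hasDerivAt_exp t₀).sub_const 1).mul hht
      · refine HasDerivAt.const_mul _ (HasDerivAt.exp ?_)
        simpa using (hasDerivAt_id t₀).const_mul 2
      · refine HasDerivAt.const_mul _ (HasDerivAt.const_add _ ?_)
        simpa using (hasDerivAt_id t₀).const_mul 3
      · exact (Real.hasDerivAt_sqrt ht₀pos.ne').const_mul D
    · intro s hs hst
      have hs1 : 0 < s := (le_max_left _ _).trans_lt hs
      have h1 := hmin x₀ s ⟨hs1.le, hst.le.trans ht₀T⟩
      have h2 := hVinc s hs hst
      have h3 := mul_le_mul_of_nonneg_left (hle x₀ s hs1)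
        (show 0 ≤ Real.exp s - 1 by linarith [Real.one_le_exp hs1.le])
      have h4 := mul_le_mul_of_nonneg_left
        (show V x₀ s ≤ V x₀ t₀ + (G t₀ - η) * (s - t₀) by linarith) (Real.exp_pos s).le
      simp only [hF, heq] at h1
      simp only [sub_self, mul_zero, add_zero]
      linarith
  have hee : Real.exp (2 * t₀) = Real.exp t₀ * Real.exp t₀ := by
    rw [← Real.exp_add]; congr 1; ring
  have hDge : Real.exp t₀ * (c * ε / Real.sqrt t₀) ≤ D * (1 / (2 * Real.sqrt t₀)) := by
    have : D * (1 / (2 * Real.sqrt t₀)) = Real.exp T * (c * ε / Real.sqrt t₀) := by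
      rw [hD]; field_simp
    rw [this]
    exact mul_le_mul_of_nonneg_right (Real.exp_le_exp.2 ht₀T) (by positivity)
  simp only [hG] at htime
  rw [hee] at htime
  nlinarith

lemma hasDerivAt_integral_comp_sub_mul {c g : ℝ → ℝ} (hc : ContDiff ℝ 1 c)
    (hcc : HasCompactSupport c) (hg : Continuous g) (x : ℝ) :
    HasDerivAt (fun x => ∫ y, c (x - y) * g y) (∫ y, deriv c (x - y) * g y) x := by
  have h := hcc.hasDerivAt_convolution_right (ContinuousLinearMap.mul ℝ ℝ) (μ := volume)
    hg.locallyIntegrable hc x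
  have e : ∀ c : ℝ → ℝ, convolution g c (ContinuousLinearMap.mul ℝ ℝ) volume =
      fun x => ∫ y, c (x - y) * g y := by
    intro c
    ext x
    simp only [convolution_def, ContinuousLinearMap.mul_apply', mul_comm (g _)]
  rwa [e, e] at h

lemma continuous_integral_comp_sub_mul {c : ℝ → ℝ} (hc : Continuous c)
    (hcc : HasCompactSupport c) {v : ℝ → ℝ → ℝ} (hv : Continuous (Function.uncurry v)) {C : ℝ}
    (hvb : ∀ x t, |v x t| ≤ C) :
    Continuous (Function.uncurry fun x t => ∫ y, c (x - y) * v y t) := by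
  have e : (Function.uncurry fun x t => ∫ y, c (x - y) * v y t)
      = fun q : ℝ × ℝ => ∫ y, c y * v (q.1 - y) q.2 := by
    ext q
    have := integral_sub_left_eq_self (fun y => c y * v (q.1 - y) q.2) volume q.1
    simpa [Function.uncurry] using this
  rw [e]
  refine continuous_of_dominated (bound := fun y => |c y| * C) ?_ ?_ ?_ ?_
  · intro q; exact Continuous.aestronglyMeasurable (by fun_prop)
  · intro q
    refine Eventually.of_forall fun y => ?_
    rw [Real.norm_eq_abs, abs_mul]
    exact mul_le_mul_of_nonneg_left (hvb _ _) (abs_nonneg _)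
  · exact ((hc.integrable_of_hasCompactSupport hcc).abs).mul_const C
  · refine Eventually.of_forall fun y => ?_
    fun_prop

lemma exists_mollifier {ε : ℝ} (hε : 0 < ε) :
    ∃ a : ℝ → ℝ, ContDiff ℝ 2 a ∧ HasCompactSupport a ∧ (∀ z, 0 ≤ a z) ∧ ∫ z, a z = 1 ∧
      ∀ z, a z ≠ 0 → |z| ≤ ε := by
  let φ : ContDiffBump (0:ℝ) := ⟨ε / 2, ε, by positivity, by linarith⟩
  refine ⟨φ.normed volume, φ.contDiff_normed (n := 2), φ.hasCompactSupport_normed,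
    φ.nonneg_normed, φ.integral_normed, fun z hz => ?_⟩
  have : z ∈ Function.support (φ.normed volume) := hz
  rw [φ.support_normed_eq] at this
  have h2 : |z| < ε := by simpa using this
  exact h2.le

/-- Averaging against a mollifier preserves inequalities valid on its support. -/
lemma integral_mollifier_mono {a : ℝ → ℝ} {ε C C' : ℝ} (ha : Continuous a)
    (hac : HasCompactSupport a) (ha0 : ∀ z, 0 ≤ a z) (has : ∀ z, a z ≠ 0 → |z| ≤ ε)
    {x : ℝ} {g₁ g₂ : ℝ → ℝ} (hg₁ : AEStronglyMeasurable g₁) (hb₁ : ∀ y, |g₁ y| ≤ C)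
    (hg₂ : AEStronglyMeasurable g₂) (hb₂ : ∀ y, |g₂ y| ≤ C')
    (h : ∀ y, |x - y| ≤ ε → g₁ y ≤ g₂ y) :
    ∫ y, a (x - y) * g₁ y ≤ ∫ y, a (x - y) * g₂ y := by
  have hc : Continuous fun y => a (x - y) := by fun_prop
  have hcc : HasCompactSupport fun y => a (x - y) :=
    hac.comp_homeomorph (Homeomorph.subLeft x)
  refine integral_mono (integrable_mul_of_bound hc hcc hg₁ hb₁)
    (integrable_mul_of_bound hc hcc hg₂ hb₂) fun y => ?_
  by_cases hy : a (x - y) = 0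
  · simp [hy]
  · exact mul_le_mul_of_nonneg_left (h y (has _ hy)) (ha0 _)

/-- One improvement step of the lower bound for a weak solution: a one-sided bound on the
absorption term with constant `N` yields a lower bound with constant `N / 2`. -/
lemma lower_bound_of_absorption_le {α β T C N : ℝ} (hα : 0 < α) (hβ : 0 < β) (hT : 0 < T)
    (hN : 0 ≤ N) {v w f : ℝ → ℝ → ℝ}
    (hv : Continuous (Function.uncurry v)) (hw : Continuous (Function.uncurry w))
    (hd : ∀ x t, HasDerivAt (fun y => v y t) (w x t) x)
    (hvb : ∀ x t, |v x t| ≤ C) (hwb : ∀ x t, |w x t| ≤ C)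
    (hf : Measurable (Function.uncurry f)) (hfb : ∀ x t, |f x t| ≤ C)
    (weak : ∀ φ φt φx : ℝ → ℝ → ℝ, IsTestFun T φ φt φx →
      (∫ t in Ioc (0:ℝ) T, ∫ x : ℝ, φt x t * v x t)
        = ∫ t in Ioc (0:ℝ) T, ∫ x : ℝ, (φx x t * w x t + f x t * φ x t))
    (hfN : ∀ x t, 0 < t → t ≤ T → f x t ≤ v x t + psi α β x t + N * Real.exp t) :
    ∀ x, ∀ t ∈ Icc (0:ℝ) T, 0 ≤ Real.exp t * v x t + (Real.exp t - 1) * psi α β x t +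
      N / 2 * Real.exp (2 * t) := by
  intro x₀ t₀ ht₀
  have hC : 0 ≤ C := (abs_nonneg _).trans (hvb 0 0)
  have hvt : ∀ t, Continuous fun y => v y t := fun t => by fun_prop
  have hft : ∀ t, Measurable fun y => f y t := fun t => by fun_prop
  have key : ∀ ε > 0, 0 ≤ (Real.exp t₀ * v x₀ t₀ + (Real.exp t₀ - 1) * psi α β x₀ t₀ +
      N / 2 * Real.exp (2 * t₀)) + ε * (Real.exp t₀ * C + (x₀ ^ 2 + 3 * t₀) +
        2 * Real.exp T * psiAmp α β * Real.sqrt t₀) := by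
    intro ε hε
    obtain ⟨a, ha, hac, ha0, ha1, has⟩ := exists_mollifier hε
    have ha' : ContDiff ℝ 1 (deriv a) := by
      have : ContDiff ℝ (1 + 1) a := by simpa [one_add_one_eq_two] using ha
      exact (contDiff_succ_iff_deriv.1 this).2.2
    have ha'' : Continuous (deriv (deriv a)) := ha'.continuous_deriv le_rfl
    have haint : ∀ x K, ∫ y, a (x - y) * K = K := by
      intro x K
      rw [integral_mul_const, integral_sub_left_eq_self, ha1, one_mul]
    have hbx : ∀ x, ContDiff ℝ 2 fun y => a (x - y) := fun x => by fun_prop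
    have hbxc : ∀ x, HasCompactSupport fun y => a (x - y) := fun x =>
      hac.comp_homeomorph (Homeomorph.subLeft x)
    have hbx'' : ∀ x y, deriv (deriv fun y => a (x - y)) y = deriv (deriv a) (x - y) := by
      intro x y
      have e : (deriv fun y => a (x - y)) = fun y => -deriv a (x - y) := by
        ext y; exact deriv_comp_const_sub a x y
      rw [e]
      have := deriv_comp_const_sub (deriv a) x y
      rw [deriv.fun_neg, this, neg_neg]
    have hid : ∀ x, ∀ t ∈ Icc (0:ℝ) T, ∫ y, a (x - y) * v y t = ∫ s in (0:ℝ)..t,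
        ((∫ y, deriv (deriv a) (x - y) * v y s) - ∫ y, a (x - y) * f y s) := by
      intro x t ht
      have := integral_mul_eq_of_weak hT hv hw hd hvb hwb hf hfb weak (hbx x) (hbxc x) t ht
      simpa only [hbx''] using this
    have hV2c := continuous_integral_comp_sub_mul ha'' hac.deriv.deriv hv hvb
    have hki : ∀ x c d, IntervalIntegrable (fun s =>
        (∫ y, deriv (deriv a) (x - y) * v y s) - ∫ y, a (x - y) * f y s) volume c d := by
      intro x c d
      refine IntervalIntegrable.sub ?_ ?_
      · exact (hV2c.comp (Continuous.prodMk_right x)).intervalIntegrable _ _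
      · exact intervalIntegrable_integral_mul (hbx x).continuous (hbxc x) hf hfb c d
    have hle : ∀ x t, ∫ y, a (x - y) * v y t ≤ C := by
      intro x t
      rw [← haint x C]
      exact integral_mollifier_mono (C := C) (C' := C) ha.continuous hac ha0 has
        (hvt t).aestronglyMeasurable (fun y => hvb y t) aestronglyMeasurable_const
        (fun _ => (abs_of_nonneg hC).le) (fun y _ => (abs_le.1 (hvb y t)).2)
    have hge : ∀ x t, -C ≤ ∫ y, a (x - y) * v y t := by
      intro x t
      rw [← haint x (-C)]
      exact integral_mollifier_mono (C := C) (C' := C) ha.continuous hac ha0 has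
        aestronglyMeasurable_const (fun _ => by rw [abs_neg, abs_of_nonneg hC])
        (hvt t).aestronglyMeasurable (fun y => hvb y t) (fun y _ => (abs_le.1 (hvb y t)).1)
    have hcomp := comparison_of_integrated_inequality (T := T) (C := C) (N := N) hα hβ hN hε
      (V := fun x t => ∫ y, a (x - y) * v y t) (V₁ := fun x t => ∫ y, deriv a (x - y) * v y t)
      (V₂ := fun x t => ∫ y, deriv (deriv a) (x - y) * v y t)
      (g := fun x t => ∫ y, a (x - y) * f y t)
      (continuous_integral_comp_sub_mul ha.continuous hac hv hvb)
      (fun x t => abs_le.2 ⟨hge x t, hle x t⟩)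
      (fun x t => hasDerivAt_integral_comp_sub_mul (ha.of_le (by norm_num)) hac (hvt t) x)
      (fun x t => hasDerivAt_integral_comp_sub_mul ha' hac.deriv (hvt t) x)
      (fun x => hV2c.comp (Continuous.prodMk_right x))
      (fun x => by rw [hid x 0 ⟨le_rfl, hT.le⟩, intervalIntegral.integral_same])
      (by
        intro x s t m hs hst ht hm
        rw [hid x t ⟨(hs.trans hst).le, ht⟩, hid x s ⟨hs.le, hst.le.trans ht⟩,
          intervalIntegral.integral_interval_sub_left (hki x _ _) (hki x _ _)]
        have := intervalIntegral.integral_mono_on hst.le (intervalIntegrable_const (c := m))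
          (hki x s t) hm
        rw [intervalIntegral.integral_const, smul_eq_mul] at this
        linarith)
      (by
        intro x r K hr hrT hK
        have e : (∫ y, a (x - y) * v y r) + K + N * Real.exp r
            = ∫ y, a (x - y) * (v y r + (K + N * Real.exp r)) := by
          simp only [mul_add]
          rw [integral_add, integral_add, haint, haint]
          · ring
          · exact (((hbx x).continuous.integrable_of_hasCompactSupport (hbxc x))).mul_const _
          · exact (((hbx x).continuous.integrable_of_hasCompactSupport (hbxc x))).mul_const _
          · exact integrable_mul_of_bound (hbx x).continuous (hbxc x)
              (hvt r).aestronglyMeasurable (fun y => hvb y r)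
          · exact (((hbx x).continuous.integrable_of_hasCompactSupport (hbxc x)).mul_const _).add
              (((hbx x).continuous.integrable_of_hasCompactSupport (hbxc x)).mul_const _)
        rw [e]
        refine integral_mollifier_mono (C := C) (C' := C + |K + N * Real.exp r|)
          ha.continuous hac ha0 has
          (hft r).aestronglyMeasurable (fun y => hfb y r)
          ((hvt r).add continuous_const).aestronglyMeasurable
          (fun y => (abs_add_le _ _).trans (add_le_add_left (hvb y r) _)) (fun y hy => ?_)
        have h1 := hfN y r hr hrT
        have h2 := hK y hy
        linarith)
      ε hε x₀ t₀ ht₀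
    have hVv : ∫ y, a (x₀ - y) * v y t₀ ≤ v x₀ t₀ + C * ε := by
      rw [← haint x₀ (v x₀ t₀ + C * ε)]
      refine integral_mollifier_mono (C := C) (C' := |v x₀ t₀ + C * ε|) ha.continuous hac ha0 has
        (hvt t₀).aestronglyMeasurable (fun y => hvb y t₀) aestronglyMeasurable_const
        (fun _ => le_rfl) (fun y hy => ?_)
      have h1 := Convex.norm_image_sub_le_of_norm_hasDerivWithin_le (C := C)
        (fun x _ => (hd x t₀).hasDerivWithinAt) (fun x _ => hwb x t₀) convex_univ
        (mem_univ x₀) (mem_univ y)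
      rw [Real.norm_eq_abs, Real.norm_eq_abs, abs_sub_comm y] at h1
      have h2 := (abs_le.1 h1).2
      have h3 := mul_le_mul_of_nonneg_left hy hC
      linarith
    have h5 := mul_le_mul_of_nonneg_left hVv (Real.exp_pos t₀).le
    nlinarith
  by_contra! hneg
  set Z := Real.exp t₀ * v x₀ t₀ + (Real.exp t₀ - 1) * psi α β x₀ t₀ +
      N / 2 * Real.exp (2 * t₀)
  set A := Real.exp t₀ * C + (x₀ ^ 2 + 3 * t₀) + 2 * Real.exp T * psiAmp α β * Real.sqrt t₀
  have h1 := key (-Z / (2 * (|A| + 1))) (div_pos (by linarith) (by positivity))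
  have h2 : -Z / (2 * (|A| + 1)) * A ≤ -Z / 2 := by
    rw [div_mul_eq_mul_div, div_le_div_iff₀ (by positivity) (by norm_num)]
    nlinarith [le_abs_self A, abs_nonneg A]
  linarith

/-- Strict positivity of the concentration `v + psi` for positive times. -/
lemma concentration_pos_of_weak {α β T C : ℝ} (hα : 0 < α) (hβ : 0 < β) (hT : 0 < T)
    {v w f : ℝ → ℝ → ℝ}
    (hv : Continuous (Function.uncurry v)) (hw : Continuous (Function.uncurry w))
    (hd : ∀ x t, HasDerivAt (fun y => v y t) (w x t) x)
    (hvb : ∀ x t, |v x t| ≤ C) (hwb : ∀ x t, |w x t| ≤ C)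
    (hf : Measurable (Function.uncurry f)) (hfb : ∀ x t, |f x t| ≤ C)
    (weak : ∀ φ φt φx : ℝ → ℝ → ℝ, IsTestFun T φ φt φx →
      (∫ t in Ioc (0:ℝ) T, ∫ x : ℝ, φt x t * v x t)
        = ∫ t in Ioc (0:ℝ) T, ∫ x : ℝ, (φx x t * w x t + f x t * φ x t))
    (hfp : ∀ x t, 0 < t → t ≤ T →
      ∃ p ∈ Icc (0:ℝ) 1, f x t = p * (v x t + psi α β x t)) :
    ∀ x t, 0 < t → t ≤ T → 0 < v x t + psi α β x t := by
  have hC : 0 ≤ C := (abs_nonneg _).trans (hvb 0 0)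
  have hind : ∀ n : ℕ, ∀ x, ∀ t ∈ Icc (0:ℝ) T,
      0 ≤ Real.exp t * v x t + (Real.exp t - 1) * psi α β x t +
        C / 2 ^ n * Real.exp (2 * t) := by
    intro n
    induction n with
    | zero =>
      intro x t ht
      have h1 := Real.one_le_exp ht.1
      have h2 : Real.exp (2 * t) = Real.exp t * Real.exp t := by
        rw [← Real.exp_add]; congr 1; ring
      have h3 := mul_nonneg (sub_nonneg.2 h1) (psi_nonneg hα hβ x t)
      have h4 := (abs_le.1 (hvb x t)).1
      rw [pow_zero, div_one, h2]
      nlinarith [mul_nonneg (sub_nonneg.2 h1) hC, Real.exp_pos t]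
    | succ n ih =>
      have e : C / 2 ^ (n + 1) = C / 2 ^ n / 2 := by rw [pow_succ]; field_simp
      rw [e]
      refine lower_bound_of_absorption_le hα hβ hT (by positivity) hv hw hd hvb hwb hf hfb weak ?_
      intro x t ht htT
      obtain ⟨p, hp, hpe⟩ := hfp x t ht htT
      have h1 := ih x t ⟨ht.le, htT⟩
      have h2 : Real.exp (2 * t) = Real.exp t * Real.exp t := by
        rw [← Real.exp_add]; congr 1; ring
      have h3 : 0 ≤ v x t + psi α β x t + C / 2 ^ n * Real.exp t := by
        have h4 := psi_nonneg hα hβ x t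
        have h5 : 0 ≤ Real.exp t * (v x t + psi α β x t + C / 2 ^ n * Real.exp t) := by
          rw [h2] at h1
          linarith
        exact nonneg_of_mul_nonneg_right h5 (Real.exp_pos t)
      have h6 : 0 ≤ C / 2 ^ n * Real.exp t := by positivity
      rw [hpe]
      nlinarith [hp.1, hp.2]
  intro x t ht htT
  have hlim : Tendsto (fun n : ℕ => Real.exp t * v x t + (Real.exp t - 1) * psi α β x t +
      C / 2 ^ n * Real.exp (2 * t)) atTop
      (nhds (Real.exp t * v x t + (Real.exp t - 1) * psi α β x t + 0 * Real.exp (2 * t))) := by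
    refine tendsto_const_nhds.add (Tendsto.mul_const _ ?_)
    exact tendsto_const_nhds.div_atTop (tendsto_pow_atTop_atTop_of_one_lt (by norm_num))
  have h0 := ge_of_tendsto' hlim fun n => hind n x t ⟨ht.le, htT⟩
  have hψ := psi_pos hα hβ (x := x) ht
  refine pos_of_mul_pos_right (a := Real.exp t) ?_ (Real.exp_pos t).le
  linarith

/-- The concentration field determines the absorption term of the weak formulation. -/
lemma absorption_ae_eq_of_weak {T C : ℝ} {v w f₁ f₂ : ℝ → ℝ → ℝ}
    (hw : Continuous (Function.uncurry w)) (hwb : ∀ x t, |w x t| ≤ C)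
    (hf₁ : Measurable (Function.uncurry f₁)) (hfb₁ : ∀ x t, |f₁ x t| ≤ C)
    (hf₂ : Measurable (Function.uncurry f₂)) (hfb₂ : ∀ x t, |f₂ x t| ≤ C)
    (weak₁ : ∀ φ φt φx : ℝ → ℝ → ℝ, IsTestFun T φ φt φx →
      (∫ t in Ioc (0:ℝ) T, ∫ x : ℝ, φt x t * v x t)
        = ∫ t in Ioc (0:ℝ) T, ∫ x : ℝ, (φx x t * w x t + f₁ x t * φ x t))
    (weak₂ : ∀ φ φt φx : ℝ → ℝ → ℝ, IsTestFun T φ φt φx →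
      (∫ t in Ioc (0:ℝ) T, ∫ x : ℝ, φt x t * v x t)
        = ∫ t in Ioc (0:ℝ) T, ∫ x : ℝ, (φx x t * w x t + f₂ x t * φ x t)) :
    ∀ᵐ q : ℝ × ℝ, q ∈ univ ×ˢ Ioo 0 T →
      Function.uncurry f₁ q - Function.uncurry f₂ q = 0 := by
  refine (isOpen_univ.prod isOpen_Ioo).ae_eq_zero_of_integral_contDiff_smul_eq_zero
    (f := fun q => Function.uncurry f₁ q - Function.uncurry f₂ q) ?_ ?_
  · refine LocallyIntegrable.locallyIntegrableOn ?_ _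
    refine (locallyIntegrable_const (C + C)).mono (hf₁.sub hf₂).aestronglyMeasurable
      (Eventually.of_forall fun q => ?_)
    rw [Real.norm_eq_abs, Real.norm_eq_abs]
    exact (abs_sub _ _).trans ((add_le_add (hfb₁ _ _) (hfb₂ _ _)).trans (le_abs_self _))
  intro g hg hgc hgs
  have hg1 : Differentiable ℝ g := hg.differentiable (by simp)
  have hfd : Continuous (fderiv ℝ g) := hg.continuous_fderiv (by simp)
  have hz : ∀ q : ℝ × ℝ, q.2 ∉ Ioo 0 T → g q = 0 := fun q hq =>
    image_eq_zero_of_notMem_tsupport fun h => hq (hgs h).2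
  have hz' : ∀ q : ℝ × ℝ, q.2 ∉ Ioo 0 T → fderiv ℝ g q = 0 := fun q hq =>
    image_eq_zero_of_notMem_tsupport fun h => hq (hgs (tsupport_fderiv_subset ℝ h)).2
  have hxc : Continuous fun q => fderiv ℝ g q (1, 0) := hfd.clm_apply continuous_const
  have htc : Continuous fun q => fderiv ℝ g q (0, 1) := hfd.clm_apply continuous_const
  have hxs : HasCompactSupport fun q => fderiv ℝ g q (1, 0) :=
    (hgc.fderiv ℝ).comp_left (g := fun L : ℝ × ℝ →L[ℝ] ℝ => L (1, 0)) rfl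
  have htest : IsTestFun T (fun x t => g (x, t)) (fun x t => fderiv ℝ g (x, t) (0, 1))
      (fun x t => fderiv ℝ g (x, t) (1, 0)) := by
    refine ⟨fun x t _ => ?_, fun x t _ => ?_, hg.continuous.continuousOn, htc.continuousOn,
      hxc.continuousOn, ?_, fun x => hz _ (by simp)⟩
    · exact ((hg1 (x, t)).hasFDerivAt.comp_hasDerivAt t
        ((hasDerivAt_const t x).prodMk (hasDerivAt_id t))).hasDerivWithinAt
    · exact (hg1 (x, t)).hasFDerivAt.comp_hasDerivAt x
        ((hasDerivAt_id x).prodMk (hasDerivAt_const x t))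
    · obtain ⟨R, hR⟩ := hgc.isCompact.isBounded.subset_closedBall 0
      refine ⟨R + 1, fun x t _ hx => image_eq_zero_of_notMem_tsupport fun h => ?_⟩
      have h1 := hR h
      rw [mem_closedBall_zero_iff] at h1
      have h2 := (norm_fst_le (x, t)).trans h1
      rw [Real.norm_eq_abs] at h2
      linarith
  have hI : ∀ f : ℝ → ℝ → ℝ, Measurable (Function.uncurry f) → (∀ x t, |f x t| ≤ C) →
      Integrable (fun q : ℝ × ℝ => g q * Function.uncurry f q) := fun f hf hfb =>
    integrable_mul_of_bound hg.continuous hgc hf.aestronglyMeasurable fun q => hfb q.1 q.2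
  have hW : Integrable fun q : ℝ × ℝ => fderiv ℝ g q (1, 0) * Function.uncurry w q :=
    integrable_mul_of_bound hxc hxs hw.aestronglyMeasurable fun q => hwb q.1 q.2
  have hiter : ∀ f : ℝ → ℝ → ℝ, Measurable (Function.uncurry f) → (∀ x t, |f x t| ≤ C) →
      (∫ t in Ioc (0:ℝ) T, ∫ x : ℝ, (fderiv ℝ g (x, t) (1, 0) * w x t + f x t * g (x, t)))
        = (∫ q : ℝ × ℝ, fderiv ℝ g q (1, 0) * Function.uncurry w q) +
          ∫ q : ℝ × ℝ, g q * Function.uncurry f q := by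
    intro f hf hfb
    rw [setIntegral_eq_integral_of_forall_compl_eq_zero, ← integral_add hW (hI f hf hfb),
      Measure.volume_eq_prod, integral_prod_symm (fun q : ℝ × ℝ =>
        fderiv ℝ g q (1, 0) * Function.uncurry w q + g q * Function.uncurry f q)
        (hW.add (hI f hf hfb))]
    · simp only [Function.uncurry, mul_comm (f _ _)]
    · intro t ht
      have ht' : t ∉ Ioo 0 T := fun h => ht (Ioo_subset_Ioc_self h)
      simp [hz (_, t) ht', hz' (_, t) ht']
  have h1 := weak₁ _ _ _ htest
  rw [weak₂ _ _ _ htest, hiter f₁ hf₁ hfb₁, hiter f₂ hf₂ hfb₂] at h1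
  simp only [smul_eq_mul, mul_sub]
  rw [integral_sub (hI f₁ hf₁ hfb₁) (hI f₂ hf₂ hfb₂)]
  linarith

/-- Projection of the time axis onto `[0,T]`. -/
def clampTime (T t : ℝ) : ℝ := max 0 (min t T)

lemma clampTime_mem {T : ℝ} (hT : 0 ≤ T) (t : ℝ) : clampTime T t ∈ Icc 0 T :=
  ⟨le_max_left _ _, max_le hT (min_le_right _ _)⟩

lemma clampTime_of_mem {T t : ℝ} (ht : t ∈ Icc 0 T) : clampTime T t = t := by
  rw [clampTime, min_eq_left ht.2, max_eq_right ht.1]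

lemma continuous_comp_clampTime {T : ℝ} (hT : 0 ≤ T) {v : ℝ → ℝ → ℝ}
    (hv : ContinuousOn (fun q : ℝ × ℝ => v q.1 q.2) (univ ×ˢ Ici 0)) :
    Continuous (Function.uncurry fun x t => v x (clampTime T t)) := by
  have hc : Continuous fun q : ℝ × ℝ => (q.1, clampTime T q.2) := by
    unfold clampTime; fun_prop
  exact hv.comp_continuous hc fun q => ⟨mem_univ _, (clampTime_mem hT q.2).1⟩

/-- The absorption term `p u`, set to zero outside the time interval `(0,T]`. -/
def absorption (T : ℝ) (p u : ℝ → ℝ → ℝ) (x t : ℝ) : ℝ :=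
  (univ ×ˢ Ioc 0 T).indicator (fun q : ℝ × ℝ => p q.1 q.2 * u q.1 q.2) (x, t)

lemma absorption_of_mem {T : ℝ} {p u : ℝ → ℝ → ℝ} {x t : ℝ} (ht : t ∈ Ioc 0 T) :
    absorption T p u x t = p x t * u x t :=
  indicator_of_mem (s := univ ×ˢ Ioc 0 T) (mk_mem_prod (mem_univ x) ht) _

lemma measurable_absorption {α β T : ℝ} {u w p : ℝ → ℝ → ℝ} (hu : AuxReg α β u w)
    (hp : Measurable fun q : ℝ × ℝ => p q.1 q.2) :
    Measurable (Function.uncurry (absorption T p u)) := by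
  classical
  have hc : ContinuousOn (fun q : ℝ × ℝ => u q.1 q.2) (univ ×ˢ Ioc 0 T) := by
    have h := (hu.2.1.mono (t := univ ×ˢ Ioi 0) (prod_mono_right Ioi_subset_Ici_self)).add
      (continuousOn_psi α β)
    refine (h.congr fun q _ => ?_).mono (prod_mono_right Ioc_subset_Ioi_self)
    simp
  have hs : MeasurableSet ((univ : Set ℝ) ×ˢ Ioc 0 T) :=
    MeasurableSet.univ.prod measurableSet_Ioc
  have hm : Measurable ((univ ×ˢ Ioc 0 T).indicator fun q : ℝ × ℝ => u q.1 q.2) := by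
    rw [← piecewise_eq_indicator]
    exact hc.measurable_piecewise continuousOn_const hs
  have e : Function.uncurry (absorption T p u) = fun q : ℝ × ℝ =>
      p q.1 q.2 * (univ ×ˢ Ioc 0 T).indicator (fun q : ℝ × ℝ => u q.1 q.2) q := by
    ext q
    by_cases hq : q ∈ (univ : Set ℝ) ×ˢ Ioc 0 T <;>
      simp only [Function.uncurry, absorption, indicator, hq, if_true, if_false, mul_zero]
  rw [e]
  exact hp.mul hm

lemma exists_bound_of_auxReg {α β T : ℝ} (hα : 0 < α) (hβ : 0 < β) (hT : 0 < T)
    {u w : ℝ → ℝ → ℝ} (hu : AuxReg α β u w) :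
    ∃ C, (∀ x, ∀ t ∈ Icc 0 T, |u x t - psi α β x t| ≤ C ∧ |w x t| ≤ C) ∧
      ∀ p : ℝ → ℝ → ℝ, (∀ x t, 0 ≤ t → p x t ∈ Icc (0:ℝ) 1) →
        ∀ x t, |absorption T p u x t| ≤ C := by
  obtain ⟨C, hC⟩ := hu.2.2.2 T hT
  have hC0 : 0 ≤ C := (abs_nonneg _).trans (hC 0 0 ⟨le_rfl, hT.le⟩).1
  have hψ0 := (psi_nonneg hα hβ 0 0).trans (psi_le hα hβ 0 0)
  refine ⟨C + psiAmp α β * gaussTail α, fun x t ht => ?_, fun p hp x t => ?_⟩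
  · have := hC x t ht
    exact ⟨by linarith [this.1], by linarith [this.2]⟩
  by_cases ht : t ∈ Ioc 0 T
  · rw [absorption_of_mem ht, abs_mul, abs_of_nonneg (hp x t ht.1.le).1]
    have h1 : |u x t| ≤ C + psiAmp α β * gaussTail α := by
      have h2 := abs_add_le (u x t - psi α β x t) (psi α β x t)
      rw [sub_add_cancel, abs_of_nonneg (psi_nonneg hα hβ x t)] at h2
      exact h2.trans (add_le_add (hC x t ⟨ht.1.le, ht.2⟩).1 (psi_le hα hβ x t))
    exact (mul_le_of_le_one_left (abs_nonneg _) (hp x t ht.1.le).2).trans h1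
  · have : absorption T p u x t = 0 := indicator_of_notMem (fun h => ht h.2) _
    rw [this, abs_zero]
    positivity

lemma weakForm_clampTime {α β T : ℝ} (hT : 0 < T) {u p w w' : ℝ → ℝ → ℝ}
    (h : WeakForm α β u p w) (hw : ∀ x t, 0 ≤ t → w x t = w' x t)
    (φ φt φx : ℝ → ℝ → ℝ) (hφ : IsTestFun T φ φt φx) :
    (∫ t in Ioc (0:ℝ) T, ∫ x : ℝ,
        φt x t * (u x (clampTime T t) - psi α β x (clampTime T t)))
      = ∫ t in Ioc (0:ℝ) T, ∫ x : ℝ,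
        (φx x t * w' x (clampTime T t) + absorption T p u x t * φ x t) := by
  have h1 := h T hT φ φt φx hφ
  have e1 : ∀ t ∈ Ioc (0:ℝ) T, clampTime T t = t := fun t ht =>
    clampTime_of_mem ⟨ht.1.le, ht.2⟩
  rw [setIntegral_congr_fun measurableSet_Ioc (g := fun t =>
      ∫ x : ℝ, φt x t * (u x t - psi α β x t)) fun t ht => by simp only [e1 t ht], h1]
  refine setIntegral_congr_fun measurableSet_Ioc fun t ht => ?_
  simp only [e1 t ht, absorption_of_mem ht, hw _ t ht.1.le]

lemma IsWeakSolution.precipitation_mem_Icc {α β ustar : ℝ} {u p : ℝ → ℝ → ℝ}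
    (h : IsWeakSolution α β ustar u p) (x t : ℝ) (ht : 0 ≤ t) : p x t ∈ Icc (0:ℝ) 1 := by
  obtain ⟨-, -, -, htri, -⟩ := h
  obtain ⟨hlt, heq, hgt⟩ := htri x t ht
  rcases lt_trichotomy (sSup ((fun s => u x s) '' Icc 0 t)) ustar with h1 | h1 | h1
  · simp [hlt h1]
  · exact heq h1
  · simp [hgt h1]

/-- the precipitation function is essentially determined by the
concentration field. -/
theorem precipitation_determined_by_concentration (α β ustar : ℝ)
    (hα : 0 < α) (hβ : 0 < β) (hu : 0 < ustar)
    (u p₁ p₂ : ℝ → ℝ → ℝ)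
    (h₁ : IsWeakSolution α β ustar u p₁) (h₂ : IsWeakSolution α β ustar u p₂)
    (T : ℝ) (hT : 0 < T) :
    ∀ᵐ q ∂((volume : Measure (ℝ × ℝ)).restrict (Set.univ ×ˢ Set.Icc (0:ℝ) T)),
      p₁ q.1 q.2 = p₂ q.1 q.2 := by
  have hp₁ := h₁.precipitation_mem_Icc
  have hp₂ := h₂.precipitation_mem_Icc
  obtain ⟨-, -, hm₁, -, -, w₁, hreg₁, wf₁⟩ := h₁
  obtain ⟨-, -, hm₂, -, -, w₂, hreg₂, wf₂⟩ := h₂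
  have hww : ∀ x t, 0 ≤ t → w₂ x t = w₁ x t := fun x t ht =>
    (hreg₂.1 t ht x).unique (hreg₁.1 t ht x)
  obtain ⟨C, hC, hCp⟩ := exists_bound_of_auxReg hα hβ hT hreg₁
  have hmem := clampTime_mem hT.le
  have hvc := continuous_comp_clampTime hT.le (v := fun x t => u x t - psi α β x t) hreg₁.2.1
  have hwc := continuous_comp_clampTime hT.le hreg₁.2.2.1
  have hwb : ∀ x t, |w₁ x (clampTime T t)| ≤ C := fun x t => (hC x _ (hmem t)).2
  have weak₁ := weakForm_clampTime hT wf₁ fun _ _ _ => rfl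
  have weak₂ := weakForm_clampTime hT wf₂ hww
  have hpos : ∀ x t, t ∈ Ioc 0 T → 0 < u x t := by
    intro x t ht
    have h := concentration_pos_of_weak hα hβ hT
      (v := fun x t => u x (clampTime T t) - psi α β x (clampTime T t))
      (w := fun x t => w₁ x (clampTime T t)) hvc hwc
      (fun x t => hreg₁.1 _ (hmem t).1 x) (fun x t => (hC x _ (hmem t)).1) hwb
      (measurable_absorption hreg₁ hm₁) (hCp p₁ hp₁) weak₁
      (fun x t ht htT => ⟨p₁ x t, hp₁ x t ht.le, by
        rw [absorption_of_mem ⟨ht, htT⟩, clampTime_of_mem ⟨ht.le, htT⟩, sub_add_cancel]⟩)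
      x t ht.1 ht.2
    rwa [clampTime_of_mem ⟨ht.1.le, ht.2⟩, sub_add_cancel] at h
  have hae := absorption_ae_eq_of_weak hwc hwb (measurable_absorption hreg₁ hm₁) (hCp p₁ hp₁)
    (measurable_absorption hreg₁ hm₂) (hCp p₂ hp₂) weak₁ weak₂
  have hset : (univ ×ˢ Icc 0 T : Set (ℝ × ℝ)) =ᵐ[volume] (univ ×ˢ Ioo 0 T : Set (ℝ × ℝ)) :=
    Measure.set_prod_ae_eq (ae_eq_refl _) Ioo_ae_eq_Icc.symm
  rw [Measure.restrict_congr_set hset,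
    ae_restrict_iff' (MeasurableSet.univ.prod measurableSet_Ioo)]
  filter_upwards [hae] with q hq hqT
  have ht : q.2 ∈ Ioc 0 T := Ioo_subset_Ioc_self hqT.2
  have h := hq hqT
  simp only [Function.uncurry, absorption_of_mem ht] at h
  exact mul_right_cancel₀ (hpos q.1 q.2 ht).ne' (sub_eq_zero.1 h)

end
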